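/- Let F be the finite field of order 121 and let α ∈ F satisfy α² = 2. Let H := {1, 9} and set C := {0} ∪ H ∪ {α+5, 9(α+5)} ∪ {10(α+6), 2(α+6)}. Then C is a maximal clique of size 7 = (11+3)/2 in the Paley graph P(121), and the setwise stabilizer of C in the automorphism group of P(121) is the group generated by σ: γ ↦ (α+5)γ and τ: γ ↦ (α+5)γ¹¹, which satisfies σ³ = 1, τ² = 1, τστ = σ⁻¹ and is isomorphic to the dihedral group of order 6. -/

import Mathlib

/-- A subset `C` of a field is a clique in the Paley graph: any two distinct
elements differ by a nonzero square. -/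
def IsPaleyClique {F : Type*} [Field F] (C : Set F) : Prop :=
  ∀ a ∈ C, ∀ b ∈ C, a ≠ b → IsSquare (a - b)

/-- A maximal clique in the Paley graph. -/
def IsMaximalPaleyClique {F : Type*} [Field F] (C : Set F) : Prop :=
  IsPaleyClique C ∧ ∀ D : Set F, IsPaleyClique D → C ⊆ D → D = C

/-- A bijection of the field is an automorphism of the Paley graph if it
preserves the adjacency relation. -/
def IsPaleyAut {F : Type*} [Field F] (f : Equiv.Perm F) : Prop :=
  ∀ a b : F, (f a ≠ f b ∧ IsSquare (f a - f b)) ↔ (a ≠ b ∧ IsSquare (a - b))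

/-- The setwise stabilizer of a vertex subset `C` inside the automorphism
group of the Paley graph. -/
def paleyStab {F : Type*} [Field F] (C : Set F) : Set (Equiv.Perm F) :=
  {f | IsPaleyAut f ∧ ⇑f '' C = C}

/-- The orbit of a vertex subset `C` under the natural action of the
automorphism group of the Paley graph on vertex subsets. -/
def paleyOrbit {F : Type*} [Field F] (C : Set F) : Set (Set F) :=
  {D | ∃ f : Equiv.Perm F, IsPaleyAut f ∧ ⇑f '' C = D}

/-- The coordinates `(a, b)` of the elements `a + b * α` of a field of order 121
in which `α ^ 2 = 2`. -/
abbrev Coord : Type := ZMod 11 × ZMod 11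

namespace Coord

/-- The norm of `a + b * α` to the prime field. -/
def norm (x : Coord) : ZMod 11 := x.1 * x.1 - 2 * (x.2 * x.2)

/-- Adjacency in the Paley graph, in coordinates. The binary digits of `570` are the
indicator of the nonzero squares modulo `11`; natural number arithmetic keeps `adj` cheap
to evaluate. -/
def adj (x y : Coord) : Bool :=
  let a := x.1.val + (11 - y.1.val)
  let b := x.2.val + (11 - y.2.val)
  Nat.beq (Nat.land (Nat.shiftRight 570 ((a * a + 9 * (b * b)) % 11)) 1) 1

/-- The coordinates of the seven elements of the clique. -/
def clique : List Coord := [(0, 0), (1, 0), (9, 0), (5, 1), (1, 9), (5, 10), (1, 2)]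

/-- Some vertex outside the clique has exactly the elements of `A` as its neighbours in
the clique. -/
def IsTrace (A : List Coord) : Prop :=
  ∃ x : Coord, x ∉ clique ∧ ∀ t ∈ clique, adj x t = true ↔ t ∈ A

instance : DecidablePred IsTrace := fun _ => inferInstanceAs (Decidable (∃ _, _))

lemma adj_eq_true_iff (x y : Coord) : adj x y = true ↔
    x ≠ y ∧ ([0, 1, 3, 4, 5, 9] : List (ZMod 11)).contains (norm (x - y)) = true := by
  have cast_sub (a b : ZMod 11) : ((a.val + (11 - b.val) : ℕ) : ZMod 11) = a - b := by
    have h11 : ((11 : ℕ) : ZMod 11) = 0 := ZMod.natCast_self 11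
    rw [Nat.cast_add, Nat.cast_sub b.val_lt.le, ZMod.natCast_zmod_val, ZMod.natCast_zmod_val, h11]
    ring
  have key : ∀ z : Coord,
      Nat.beq (Nat.land (Nat.shiftRight 570 (norm z).val) 1) 1 = true ↔
        z ≠ 0 ∧ ([0, 1, 3, 4, 5, 9] : List (ZMod 11)).contains (norm z) = true := by
    decide +kernel
  rw [← sub_ne_zero, ← key, adj, ← ZMod.val_natCast]
  have h9 : ((9 : ℕ) : ZMod 11) = -2 := by decide
  simp only [Nat.cast_add _ (9 * _), Nat.cast_mul, cast_sub, h9, norm, Prod.fst_sub, Prod.snd_sub,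
    neg_mul, ← sub_eq_add_neg]

lemma exists_sq_of_norm : ∀ x : Coord,
    ([0, 1, 3, 4, 5, 9] : List (ZMod 11)).contains (norm x) = true →
      ∃ y : Coord, (y.1 * y.1 + 2 * (y.2 * y.2), 2 * (y.1 * y.2)) = x := by
  decide +kernel

lemma eq_zero_of_mul_self : ∀ a b : ZMod 11, a * a = 2 * (b * b) → ((a, b) : Coord) = 0 := by
  decide +kernel

lemma contains_mul_self :
    ∀ a : ZMod 11, ([0, 1, 3, 4, 5, 9] : List (ZMod 11)).contains (a * a) = true := by
  decide +kernel

lemma adj_of_mem_clique : ∀ x ∈ clique, ∀ y ∈ clique, x ≠ y → adj x y = true := by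
  decide +kernel

lemma mem_clique_of_forall_adj : ∀ x : Coord, (∀ t ∈ clique, x ≠ t → adj x t = true) →
    x ∈ clique := by
  decide +kernel

lemma isTrace_singleton_iff : ∀ c ∈ clique,
    IsTrace [c] ↔ c ∈ ([(1, 0), (5, 1), (5, 10)] : List Coord) := by
  decide +kernel

lemma isTrace_pair_iff : ∀ c ∈ clique,
    ((IsTrace [c, (5, 1)] ∧ IsTrace [c, (5, 10)]) ↔ c = (9, 0)) ∧
    ((IsTrace [c, (1, 0)] ∧ IsTrace [c, (5, 10)]) ↔ c = (1, 9)) ∧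
    ((IsTrace [c, (1, 0)] ∧ IsTrace [c, (5, 1)]) ↔ c = (1, 2)) := by
  decide +kernel

lemma isTrace_triple_iff : ∀ c ∈ clique,
    (IsTrace [c, (1, 0), (5, 1)] ∧ IsTrace [c, (1, 0), (5, 10)] ∧
      IsTrace [c, (5, 1), (5, 10)]) ↔ c = (0, 0) := by
  decide +kernel

lemma eq_two_or_eq_four : ∀ x : Coord, (∀ t ∈ clique, adj x t = adj (2, 0) t) →
    x = (2, 0) ∨ x = (4, 0) := by
  decide +kernel

lemma not_four : ∀ x : Coord, ¬ ((∀ t ∈ clique, adj x t = adj (4, 1) t) ∧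
    adj x (4, 0) = adj (4, 1) (2, 0)) := by
  decide +kernel

lemma eq_of_adj_clique_two : ∀ u ∈ ([(8, 2), (6, 1), (4, 2)] : List Coord), ∀ x : Coord,
    (∀ t ∈ (2, 0) :: clique, adj x t = adj u t) → x = u := by
  decide +kernel

/-- The adjacencies between `x` and the elements of `T`, as binary digits. -/
def code (T : List Coord) (x : Coord) : ℕ :=
  (T.map (adj x)).foldl (fun n b => 2 * n + b.toNat) 0

lemma eq_of_code_eq : ∀ u x : Coord,
    code ((8, 2) :: (6, 1) :: (4, 2) :: (2, 0) :: clique) x =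
      code ((8, 2) :: (6, 1) :: (4, 2) :: (2, 0) :: clique) u → x = u := by
  decide +kernel

lemma eq_of_adj_resolving (u x : Coord)
    (h : ∀ t ∈ (8, 2) :: (6, 1) :: (4, 2) :: (2, 0) :: clique, adj x t = adj u t) : x = u :=
  eq_of_code_eq u x (by rw [code, code, List.map_congr_left h])

/-- A permutation preserving the coordinate Paley graph and its clique. -/
structure Stabilizes (g : Equiv.Perm Coord) : Prop where
  adj_map : ∀ x y, adj (g x) (g y) = adj x y
  mem_map : ∀ x, g x ∈ clique ↔ x ∈ clique

namespace Stabilizes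

variable {g : Equiv.Perm Coord}

lemma isTrace_map (hg : Stabilizes g) {A : List Coord} (h : IsTrace A) :
    IsTrace (A.map g) := by
  obtain ⟨x, hx, hA⟩ := h
  refine ⟨g x, fun h => hx ((hg.mem_map x).1 h), fun t ht => ?_⟩
  obtain ⟨t, rfl⟩ := g.surjective t
  rw [hg.adj_map, hA t ((hg.mem_map t).1 ht), List.mem_map_of_injective g.injective]

lemma map_mem_of_isTrace_singleton (hg : Stabilizes g) {c : Coord}
    (hc : c ∈ ([(1, 0), (5, 1), (5, 10)] : List Coord)) :
    g c ∈ ([(1, 0), (5, 1), (5, 10)] : List Coord) := by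
  have hmem : c ∈ clique := by
    revert c
    decide +kernel
  exact (isTrace_singleton_iff _ ((hg.mem_map c).2 hmem)).1
    (hg.isTrace_map ((isTrace_singleton_iff c hmem).2 hc))

lemma map_eq_of_mem_clique (hg : Stabilizes g) (h₁ : g (1, 0) = (1, 0))
    (h₂ : g (5, 1) = (5, 1)) : ∀ t ∈ clique, g t = t := by
  have h₃ : g (5, 10) = (5, 10) := by
    have h := hg.map_mem_of_isTrace_singleton (c := (5, 10)) (by decide)
    have n₁ : g (5, 10) ≠ (1, 0) := fun e =>
      absurd (g.injective (e.trans h₁.symm)) (by decide)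
    have n₂ : g (5, 10) ≠ (5, 1) := fun e =>
      absurd (g.injective (e.trans h₂.symm)) (by decide)
    simpa [n₁, n₂] using h
  have mem (c : Coord) (hc : c ∈ clique) : g c ∈ clique := (hg.mem_map c).2 hc
  have tr {A : List Coord} (h : IsTrace A) := hg.isTrace_map h
  have m₀ : ((0, 0) : Coord) ∈ clique := by decide
  have m₉ : ((9, 0) : Coord) ∈ clique := by decide
  have m₉' : ((1, 9) : Coord) ∈ clique := by decide
  have m₉'' : ((1, 2) : Coord) ∈ clique := by decide
  have h₀ : g (0, 0) = (0, 0) := by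
    obtain ⟨a, b, c⟩ := (isTrace_triple_iff _ m₀).2 rfl
    have a := tr a; have b := tr b; have c := tr c
    simp only [List.map, h₁, h₂, h₃] at a b c
    exact (isTrace_triple_iff _ (mem _ m₀)).1 ⟨a, b, c⟩
  have h₉ : g (9, 0) = (9, 0) := by
    obtain ⟨a, b⟩ := (isTrace_pair_iff _ m₉).1.2 rfl
    have a := tr a; have b := tr b
    simp only [List.map, h₂, h₃] at a b
    exact (isTrace_pair_iff _ (mem _ m₉)).1.1 ⟨a, b⟩
  have h₉' : g (1, 9) = (1, 9) := by
    obtain ⟨a, b⟩ := (isTrace_pair_iff _ m₉').2.1.2 rfl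
    have a := tr a; have b := tr b
    simp only [List.map, h₁, h₃] at a b
    exact (isTrace_pair_iff _ (mem _ m₉')).2.1.1 ⟨a, b⟩
  have h₉'' : g (1, 2) = (1, 2) := by
    obtain ⟨a, b⟩ := (isTrace_pair_iff _ m₉'').2.2.2 rfl
    have a := tr a; have b := tr b
    simp only [List.map, h₁, h₂] at a b
    exact (isTrace_pair_iff _ (mem _ m₉'')).2.2.1 ⟨a, b⟩
  simp [clique, h₀, h₁, h₂, h₃, h₉, h₉', h₉'']

lemma eq_one (hg : Stabilizes g) (h₁ : g (1, 0) = (1, 0)) (h₂ : g (5, 1) = (5, 1)) :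
    g = 1 := by
  have adj_fixed {t : Coord} (ht : g t = t) (x : Coord) : adj (g x) t = adj x t := by
    rw [← hg.adj_map x t, ht]
  have hC := hg.map_eq_of_mem_clique h₁ h₂
  have h2 : g (2, 0) = (2, 0) := by
    refine (eq_two_or_eq_four _ fun t ht => adj_fixed (hC t ht) _).resolve_right fun h4 => ?_
    exact not_four (g (4, 1)) ⟨fun t ht => adj_fixed (hC t ht) _, by rw [← h4, hg.adj_map]⟩
  have hC2 : ∀ t ∈ (2, 0) :: clique, g t = t := List.forall_mem_cons.2 ⟨h2, hC⟩
  have hU (u) (hu : u ∈ ([(8, 2), (6, 1), (4, 2)] : List Coord)) : g u = u :=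
    eq_of_adj_clique_two u hu _ fun t ht => adj_fixed (hC2 t ht) _
  have hR : ∀ t ∈ (8, 2) :: (6, 1) :: (4, 2) :: (2, 0) :: clique, g t = t := by
    simp only [List.forall_mem_cons]
    exact ⟨hU _ (by simp), hU _ (by simp), hU _ (by simp), h2, hC⟩
  exact Equiv.ext fun u => eq_of_adj_resolving u _ fun t ht => adj_fixed (hR t ht) _

end Stabilizes

/-- Multiplication by `α + 5` in coordinates. -/
def rot (x : Coord) : Coord := (5 * x.1 + 2 * x.2, x.1 + 5 * x.2)

/-- The Frobenius map followed by multiplication by `α + 5`, in coordinates. -/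
def refl (x : Coord) : Coord := rot (x.1, -x.2)

lemma rot_rot_rot : ∀ x, rot (rot (rot x)) = x := by
  decide +kernel

lemma refl_refl : ∀ x, refl (refl x) = x := by
  decide +kernel

lemma refl_rot_refl_rot : ∀ x, refl (rot (refl (rot x))) = x := by
  decide +kernel

lemma rot_mem_clique : ∀ x ∈ clique, rot x ∈ clique := by
  decide +kernel

lemma refl_mem_clique : ∀ x ∈ clique, refl x ∈ clique := by
  decide +kernel

end Coord

namespace DihedralGroup

variable {G : Type*} [Group G] {n : ℕ} {s t : G}

/-- The homomorphism from the dihedral group determined by elements `s`, `t` satisfying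
the dihedral relations. -/
def lift (hs : s ^ n = 1) (ht : t ^ 2 = 1) (hst : t * s * t = s⁻¹) : DihedralGroup n →* G :=
  let p : ZMod n →+ Additive G := ZMod.lift n
    ⟨zmultiplesHom (Additive G) (Additive.ofMul s), by
      simp [← ofMul_pow, hs]⟩
  have hp (k : ℤ) : (p k).toMul = s ^ k := by simp [p]
  have htt : t * t = 1 := by rw [← sq, ht]
  have hpt (i : ZMod n) : (p i).toMul * t = t * (p (-i)).toMul := by
    obtain ⟨k, rfl⟩ := ZMod.intCast_surjective i
    have ht' : t⁻¹ = t := inv_eq_of_mul_eq_one_left htt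
    have h : t * s ^ k * t = (s ^ k)⁻¹ := by
      have := conj_zpow (i := k) (a := t) (b := s)
      rw [ht', hst] at this
      rw [← this, inv_zpow]
    rw [map_neg, toMul_neg, hp, ← h, ← mul_assoc, ← mul_assoc, htt, one_mul]
  MonoidHom.mk'
    (fun
      | r i => (p i).toMul
      | sr i => t * (p i).toMul)
    (by
      rintro (i | i) (j | j)
      · simp
      · simp only [r_mul_sr, ← mul_assoc, hpt]
        rw [mul_assoc, ← toMul_add, ← map_add, neg_add_eq_sub]
      · simp [mul_assoc]
      · simp only [sr_mul_sr]
        rw [mul_assoc, ← mul_assoc _ t, hpt, mul_assoc, ← mul_assoc t t, htt, one_mul,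
          ← toMul_add, ← map_add, neg_add_eq_sub])

variable (hs : s ^ n = 1) (ht : t ^ 2 = 1) (hst : t * s * t = s⁻¹)

lemma lift_r_intCast (k : ℤ) : lift hs ht hst (r k) = s ^ k := by
  simp [lift]

lemma lift_sr_intCast (k : ℤ) : lift hs ht hst (sr k) = t * s ^ k := by
  simp [lift]

lemma range_lift : (lift hs ht hst).range = Subgroup.closure {s, t} := by
  apply le_antisymm
  · rintro _ ⟨i | i, rfl⟩ <;> obtain ⟨k, rfl⟩ := ZMod.intCast_surjective i
    · rw [lift_r_intCast]
      exact zpow_mem (Subgroup.subset_closure (by simp)) k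
    · rw [lift_sr_intCast]
      exact mul_mem (Subgroup.subset_closure (by simp))
        (zpow_mem (Subgroup.subset_closure (by simp)) k)
  · rw [Subgroup.closure_le]
    rintro _ (rfl | rfl)
    · exact ⟨r (1 : ℤ), by rw [lift_r_intCast, zpow_one]⟩
    · exact ⟨sr (0 : ℤ), by rw [lift_sr_intCast, zpow_zero, mul_one]⟩

lemma lift_injective (ho : orderOf s = n) (hts : t ∉ Subgroup.zpowers s) :
    Function.Injective (lift hs ht hst) := by
  rw [injective_iff_map_eq_one]
  rintro (i | i) h <;> obtain ⟨k, rfl⟩ := ZMod.intCast_surjective i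
  · rw [lift_r_intCast, ← orderOf_dvd_iff_zpow_eq_one, ho] at h
    rw [one_def, (ZMod.intCast_zmod_eq_zero_iff_dvd k n).2 h]
  · rw [lift_sr_intCast] at h
    exact absurd ⟨-k, (zpow_neg s k).trans (eq_inv_of_mul_eq_one_left h).symm⟩ hts

/-- A group generated by two elements satisfying exactly the dihedral relations is
dihedral. -/
noncomputable def closureEquiv (ho : orderOf s = n) (hts : t ∉ Subgroup.zpowers s) :
    Subgroup.closure {s, t} ≃* DihedralGroup n :=
  (MulEquiv.subgroupCongr (range_lift hs ht hst)).symm.trans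
    (MonoidHom.ofInjective (lift_injective hs ht hst ho hts)).symm

end DihedralGroup

namespace Coord

variable {F : Type*} [Field F] [CharP F 11]

/-- The field element `a + b * α` with given coordinates `(a, b)`. -/
def eval (α : F) (x : Coord) : F :=
  ZMod.castHom (dvd_refl 11) F x.1 + ZMod.castHom (dvd_refl 11) F x.2 * α

lemma eval_sub (α : F) (x y : Coord) : eval α (x - y) = eval α x - eval α y := by
  simp only [eval, Prod.fst_sub, Prod.snd_sub, map_sub]
  ring

variable {α : F}

lemma eval_injective (hα : α ^ 2 = 2) : Function.Injective (eval α) := by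
  have : Fact (Nat.Prime 11) := ⟨by norm_num⟩
  intro x y hxy
  rw [← sub_eq_zero, ← eval_sub] at hxy
  rw [← sub_eq_zero]
  generalize x - y = z at hxy
  obtain ⟨a, b⟩ := z
  have hinj := (ZMod.castHom (dvd_refl 11) F).injective
  have hab : a * a = 2 * (b * b) := hinj (by
    simp only [eval] at hxy
    simp only [map_mul, map_ofNat]
    linear_combination (ZMod.castHom (dvd_refl 11) F a - ZMod.castHom (dvd_refl 11) F b * α) * hxy
      + ZMod.castHom (dvd_refl 11) F b ^ 2 * hα)
  exact eq_zero_of_mul_self a b hab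

lemma eval_sq (hα : α ^ 2 = 2) (x : Coord) :
    eval α x * eval α x = eval α (x.1 * x.1 + 2 * (x.2 * x.2), 2 * (x.1 * x.2)) := by
  simp only [eval, map_add, map_mul, map_ofNat]
  linear_combination ZMod.castHom (dvd_refl 11) F x.2 ^ 2 * hα

lemma eval_rot (hα : α ^ 2 = 2) (x : Coord) : eval α (rot x) = (α + 5) * eval α x := by
  simp only [eval, rot, map_add, map_mul, map_ofNat]
  linear_combination -ZMod.castHom (dvd_refl 11) F x.2 * hα

lemma eval_refl (hα : α ^ 2 = 2) (x : Coord) : eval α (refl x) = (α + 5) * eval α x ^ 11 := by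
  have h11 : (11 : F) = 0 := by exact_mod_cast CharP.cast_eq_zero F 11
  have : Fact (Nat.Prime 11) := ⟨by norm_num⟩
  have hα11 : α ^ 11 = -α := by
    linear_combination (α ^ 9 + 2 * α ^ 7 + 4 * α ^ 5 + 8 * α ^ 3 + 16 * α) * hα + 3 * α * h11
  rw [refl, eval_rot hα, eval, eval, add_pow_char, mul_pow, ← map_pow, ← map_pow,
    ZMod.pow_card, ZMod.pow_card, hα11, map_neg]
  ring

variable [Fintype F]

/-- Coordinates identify `ZMod 11 × ZMod 11` with a field of order 121. -/
noncomputable def evalEquiv (hα : α ^ 2 = 2) (hF : Fintype.card F = 121) : Coord ≃ F :=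
  Equiv.ofBijective (eval α) ((Fintype.bijective_iff_injective_and_card _).2
    ⟨eval_injective hα, by simp [hF, ZMod.card]⟩)

lemma exists_eval (hα : α ^ 2 = 2) (hF : Fintype.card F = 121) (a : F) :
    ∃ x, eval α x = a :=
  (evalEquiv hα hF).surjective a

lemma isSquare_eval_iff (hα : α ^ 2 = 2) (hF : Fintype.card F = 121) (x : Coord) :
    IsSquare (eval α x) ↔
    ([0, 1, 3, 4, 5, 9] : List (ZMod 11)).contains (norm x) = true := by
  constructor
  · rintro ⟨r, hr⟩
    obtain ⟨y, rfl⟩ := exists_eval hα hF r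
    rw [eval_sq hα] at hr
    rw [eval_injective hα hr]
    convert contains_mul_self (norm y) using 2
    simp only [norm]
    ring
  · intro h
    obtain ⟨y, hy⟩ := exists_sq_of_norm x h
    exact ⟨eval α y, by rw [eval_sq hα, hy]⟩

lemma adj_iff (hα : α ^ 2 = 2) (hF : Fintype.card F = 121) (x y : Coord) :
    adj x y = true ↔ eval α x ≠ eval α y ∧ IsSquare (eval α x - eval α y) := by
  rw [← eval_sub, isSquare_eval_iff hα hF, (eval_injective hα).ne_iff, adj_eq_true_iff]

end Coord

/-- The clique of size 7 in the Paley graph of order 121. -/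
def paleyClique₇ {F : Type*} [Field F] (α : F) : Set F :=
  {0, 1, 9, α + 5, 9 * (α + 5), 10 * (α + 6), 2 * (α + 6)}

/-- The setwise stabilizer in the Paley graph, as a subgroup. -/
def paleyStabSubgroup {F : Type*} [Field F] (C : Set F) : Subgroup (Equiv.Perm F) where
  carrier := paleyStab C
  one_mem' := ⟨fun _ _ => Iff.rfl, Set.image_id C⟩
  mul_mem' := fun {f g} hf hg => ⟨fun a b => (hf.1 (g a) (g b)).trans (hg.1 a b), by
    rw [Equiv.Perm.coe_mul, Set.image_comp, hg.2, hf.2]⟩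
  inv_mem' := fun {f} hf => ⟨fun a b => by
      simpa using (hf.1 (f⁻¹ a) (f⁻¹ b)).symm, by
    conv_lhs => rw [← hf.2]
    rw [← Set.image_comp, ← Equiv.Perm.coe_mul, inv_mul_cancel, Equiv.Perm.coe_one, Set.image_id]⟩

lemma isPaleyAut_of_isSquare_iff {F : Type*} [Field F] {f : Equiv.Perm F}
    (h : ∀ a b, IsSquare (f a - f b) ↔ IsSquare (a - b)) : IsPaleyAut f :=
  fun a b => and_congr f.injective.ne_iff (h a b)

namespace paleyClique₇

open Coord

variable {F : Type*} [Field F] [CharP F 11] {α : F}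

lemma eq_image : paleyClique₇ α = eval α '' {x | x ∈ clique} := by
  have h11 : (11 : F) = 0 := by exact_mod_cast CharP.cast_eq_zero F 11
  have h : {x | x ∈ clique} =
      ({(0, 0), (1, 0), (9, 0), (5, 1), (1, 9), (5, 10), (1, 2)} : Set Coord) := by
    ext; simp [clique]
  have h₁ : 9 * (5 + α) = 1 + 9 * α := by linear_combination 4 * h11
  have h₂ : 10 * (α + 6) = 5 + 10 * α := by linear_combination 5 * h11
  have h₃ : 2 * (α + 6) = 1 + 2 * α := by linear_combination h11
  simp only [h, Set.image_insert_eq, Set.image_singleton, paleyClique₇, eval, map_zero, map_one,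
    map_ofNat, h₂, h₃, zero_mul, one_mul, add_zero, add_comm α 5, h₁]

lemma eval_mem_iff (hα : α ^ 2 = 2) (x : Coord) : eval α x ∈ paleyClique₇ α ↔ x ∈ clique := by
  rw [eq_image, (eval_injective hα).mem_set_image, Set.mem_ofPred_eq]

lemma ncard_eq (hα : α ^ 2 = 2) : (paleyClique₇ α).ncard = 7 := by
  rw [eq_image, Set.ncard_image_of_injective _ (eval_injective hα), ← List.coe_toFinset,
    Set.ncard_coe_finset]
  decide +kernel

lemma mem_paleyStab [Finite F] {f : Equiv.Perm F} (hf : IsPaleyAut f) {p : Coord → Coord}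
    (hp : ∀ x, f (eval α x) = eval α (p x)) (hC : ∀ x ∈ clique, p x ∈ clique) :
    f ∈ paleyStab (paleyClique₇ α) := by
  refine ⟨hf, Set.eq_of_subset_of_ncard_le ?_ ?_ (Set.toFinite _)⟩
  · rw [eq_image]
    rintro _ ⟨_, ⟨x, hx, rfl⟩, rfl⟩
    exact ⟨p x, hC x hx, (hp x).symm⟩
  · rw [Set.ncard_image_of_injective _ f.injective]

variable [Fintype F]

lemma isMaximalPaleyClique (hα : α ^ 2 = 2) (hF : Fintype.card F = 121) :
    IsMaximalPaleyClique (paleyClique₇ α) := by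
  refine ⟨?_, fun D hD hCD => (Set.Subset.antisymm hCD fun d hd => ?_).symm⟩
  · rw [eq_image]
    rintro _ ⟨x, hx, rfl⟩ _ ⟨y, hy, rfl⟩ hne
    exact ((adj_iff hα hF x y).1 (adj_of_mem_clique x hx y hy (ne_of_apply_ne _ hne))).2
  · obtain ⟨x, rfl⟩ := exists_eval hα hF d
    refine (eval_mem_iff hα x).2 (mem_clique_of_forall_adj x fun t ht hxt => ?_)
    have hne := (eval_injective hα).ne hxt
    exact (adj_iff hα hF x t).2 ⟨hne, hD _ hd _ (hCD ((eval_mem_iff hα t).2 ht)) hne⟩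

lemma stabilizes (hα : α ^ 2 = 2) (hF : Fintype.card F = 121) {f : Equiv.Perm F}
    (hf : f ∈ paleyStab (paleyClique₇ α)) :
    Stabilizes ((evalEquiv hα hF).permCongr.symm f) := by
  have he (x) : eval α ((evalEquiv hα hF).permCongr.symm f x) = f (eval α x) :=
    (evalEquiv hα hF).apply_symm_apply _
  refine ⟨fun x y => ?_, fun x => ?_⟩
  · rw [Bool.eq_iff_iff, adj_iff hα hF, adj_iff hα hF, he, he]
    exact hf.1 _ _
  · rw [← eval_mem_iff hα, ← eval_mem_iff hα, he]
    conv_lhs => rw [← hf.2]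
    exact f.injective.mem_set_image

lemma eq_of_mem_paleyStab (hα : α ^ 2 = 2) (hF : Fintype.card F = 121)
    {f k : Equiv.Perm F} (hf : f ∈ paleyStab (paleyClique₇ α))
    (hk : k ∈ paleyStab (paleyClique₇ α)) (h₁ : f (eval α (1, 0)) = k (eval α (1, 0)))
    (h₂ : f (eval α (5, 1)) = k (eval α (5, 1))) : f = k := by
  have hkf : k⁻¹ * f ∈ paleyStabSubgroup (paleyClique₇ α) :=
    mul_mem (inv_mem (show k ∈ paleyStabSubgroup _ from hk)) hf
  have key {x : Coord} (h : f (eval α x) = k (eval α x)) :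
      (evalEquiv hα hF).permCongr.symm (k⁻¹ * f) x = x := by
    refine (evalEquiv hα hF).injective (((evalEquiv hα hF).apply_symm_apply _).trans ?_)
    exact (congrArg (k⁻¹ ·) h).trans (k.symm_apply_apply _)
  have h := (stabilizes hα hF hkf).eq_one (key h₁) (key h₂)
  have h' : k⁻¹ * f = 1 := (evalEquiv hα hF).permCongr.symm.injective
    (h.trans (Equiv.ext fun x => ((evalEquiv hα hF).symm_apply_apply x).symm))
  exact (inv_mul_eq_one.1 h').symm

lemma paleyStab_subset_closure (hα : α ^ 2 = 2) (hF : Fintype.card F = 121)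
    {σ τ : Equiv.Perm F} (hσ : ∀ x, σ (eval α x) = eval α (rot x))
    (hτ : ∀ x, τ (eval α x) = eval α (refl x)) (hσC : σ ∈ paleyStab (paleyClique₇ α))
    (hτC : τ ∈ paleyStab (paleyClique₇ α)) :
    paleyStab (paleyClique₇ α) ⊆ (Subgroup.closure {σ, τ} : Set (Equiv.Perm F)) := by
  intro f hf
  have hs : σ ∈ Subgroup.closure {σ, τ} := Subgroup.subset_closure (by simp)
  have ht : τ ∈ Subgroup.closure {σ, τ} := Subgroup.subset_closure (by simp)
  have hle : Subgroup.closure {σ, τ} ≤ paleyStabSubgroup (paleyClique₇ α) :=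
    (Subgroup.closure_le _).2 (Set.insert_subset hσC (Set.singleton_subset_iff.2 hτC))
  set g := (evalEquiv hα hF).permCongr.symm f
  have hg : Stabilizes g := stabilizes hα hF hf
  have he (x) : f (eval α x) = eval α (g x) :=
    ((evalEquiv hα hF).apply_symm_apply _).symm
  have key (k : Equiv.Perm F) (p : Coord → Coord) (hk : k ∈ Subgroup.closure {σ, τ})
      (hkp : ∀ x, k (eval α x) = eval α (p x)) (h₁ : g (1, 0) = p (1, 0))
      (h₂ : g (5, 1) = p (5, 1)) : f ∈ Subgroup.closure {σ, τ} := by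
    rwa [eq_of_mem_paleyStab hα hF hf (hle hk) (by rw [he, hkp, h₁]) (by rw [he, hkp, h₂])]
  have m₁ := hg.map_mem_of_isTrace_singleton (c := (1, 0)) (by decide)
  have m₂ := hg.map_mem_of_isTrace_singleton (c := (5, 1)) (by decide)
  have hne : g (1, 0) ≠ g (5, 1) := g.injective.ne (by decide)
  generalize g (1, 0) = a at *
  generalize g (5, 1) = b at *
  simp only [List.mem_cons, List.not_mem_nil, or_false] at m₁ m₂
  rcases m₁ with rfl | rfl | rfl <;> rcases m₂ with rfl | rfl | rfl
  · exact absurd rfl hne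
  · exact key 1 id (one_mem _) (fun _ => rfl) rfl rfl
  · exact key (σ * σ * τ) (rot ∘ rot ∘ refl) (mul_mem (mul_mem hs hs) ht)
      (fun x => by simp [hσ, hτ]) (by decide) (by decide)
  · exact key τ refl ht hτ (by decide) (by decide)
  · exact absurd rfl hne
  · exact key σ rot hs hσ (by decide) (by decide)
  · exact key (σ * σ) (rot ∘ rot) (mul_mem hs hs) (fun x => by simp [hσ]) (by decide) (by decide)
  · exact key (σ * τ) (rot ∘ refl) (mul_mem hs ht) (fun x => by simp [hσ, hτ])
      (by decide) (by decide)
  · exact absurd rfl hne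

end paleyClique₇

theorem stabilizer_C11 (F : Type*) [Field F] [Fintype F] (hF : Fintype.card F = 121)
    (α : F) (hα : α ^ 2 = 2) :
    IsMaximalPaleyClique ({0, 1, 9, α + 5, 9 * (α + 5), 10 * (α + 6),
        2 * (α + 6)} : Set F) ∧
    ({0, 1, 9, α + 5, 9 * (α + 5), 10 * (α + 6), 2 * (α + 6)} : Set F).ncard = 7 ∧
    ∃ σ τ : Equiv.Perm F,
      (∀ γ : F, σ γ = (α + 5) * γ) ∧ (∀ γ : F, τ γ = (α + 5) * γ ^ 11) ∧
      σ ^ 3 = 1 ∧ τ ^ 2 = 1 ∧ τ * σ * τ = σ⁻¹ ∧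
      (Subgroup.closure ({σ, τ} : Set (Equiv.Perm F)) : Set (Equiv.Perm F))
        = paleyStab ({0, 1, 9, α + 5, 9 * (α + 5), 10 * (α + 6),
            2 * (α + 6)} : Set F) ∧
      Nonempty (↥(Subgroup.closure ({σ, τ} : Set (Equiv.Perm F))) ≃* DihedralGroup 3) := by
  have : CharP F 11 :=
    have : Fact (Nat.Prime 11) := ⟨by norm_num⟩
    charP_of_card_eq_prime_pow (hF.trans (by norm_num : 121 = 11 ^ 2))
  have hinj := Coord.eval_injective hα
  have ext {f g : Equiv.Perm F}
      (h : ∀ x, f (Coord.eval α x) = g (Coord.eval α x)) : f = g :=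
    Equiv.ext fun a => by
      obtain ⟨x, rfl⟩ := Coord.exists_eval hα hF a
      exact h x
  let e := Coord.evalEquiv hα hF
  let σ : Equiv.Perm F := e.permCongr
    ⟨Coord.rot, Coord.rot ∘ Coord.rot, Coord.rot_rot_rot, Coord.rot_rot_rot⟩
  let τ : Equiv.Perm F := e.permCongr
    ⟨Coord.refl, Coord.refl, Coord.refl_refl, Coord.refl_refl⟩
  have hσ (x) : σ (Coord.eval α x) = Coord.eval α (Coord.rot x) :=
    congrArg (fun y => e (Coord.rot y)) (e.symm_apply_apply x)
  have hτ (x) : τ (Coord.eval α x) = Coord.eval α (Coord.refl x) :=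
    congrArg (fun y => e (Coord.refl y)) (e.symm_apply_apply x)
  have hσ' (γ : F) : σ γ = (α + 5) * γ := by
    obtain ⟨x, rfl⟩ := Coord.exists_eval hα hF γ
    rw [hσ, Coord.eval_rot hα]
  have hτ' (γ : F) : τ γ = (α + 5) * γ ^ 11 := by
    obtain ⟨x, rfl⟩ := Coord.exists_eval hα hF γ
    rw [hτ, Coord.eval_refl hα]
  have hσ3 : σ ^ 3 = 1 := ext fun x => by simp [pow_succ, hσ, Coord.rot_rot_rot]
  have hτ2 : τ ^ 2 = 1 := ext fun x => by simp [pow_succ, hτ, Coord.refl_refl]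
  have hτστ : τ * σ * τ = σ⁻¹ := by
    rw [eq_inv_iff_mul_eq_one]
    exact ext fun x => by simp [hσ, hτ, Coord.refl_rot_refl_rot]
  have hω : IsSquare (α + 5) := by
    have h : Coord.eval α (5, 1) = α + 5 := by
      simp only [Coord.eval, map_one, map_ofNat, one_mul, add_comm α]
    rw [← h, Coord.isSquare_eval_iff hα hF]
    decide
  have hω0 : α + 5 ≠ 0 := fun h => by
    have := hσ' 1
    rw [h, zero_mul, ← mul_zero (α + 5), ← hσ'] at this
    exact one_ne_zero (σ.injective this)
  have hωx (x : F) : IsSquare ((α + 5) * x) ↔ IsSquare x :=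
    ⟨fun h => by simpa [hω0] using hω.inv.mul h, hω.mul⟩
  have hσC := paleyClique₇.mem_paleyStab (isPaleyAut_of_isSquare_iff fun a b => by
    rw [hσ', hσ', ← mul_sub, hωx]) hσ Coord.rot_mem_clique
  have hτC := paleyClique₇.mem_paleyStab (isPaleyAut_of_isSquare_iff fun a b => by
    have : Fact (Nat.Prime 11) := ⟨by norm_num⟩
    rw [hτ', hτ', ← mul_sub, hωx, ← sub_pow_char]
    refine ⟨fun h => ?_, fun h => h.pow 11⟩
    have := h.pow 11
    rwa [← pow_mul, show 11 * 11 = Fintype.card F from hF.symm, FiniteField.pow_card] at this)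
    hτ Coord.refl_mem_clique
  have hσ1 : σ ≠ 1 := fun h => by
    have := hσ (1, 0)
    rw [h] at this
    exact absurd (hinj this) (by decide)
  have hτσ : τ ∉ Subgroup.zpowers σ := by
    rintro ⟨k, hk⟩
    have h : τ * σ = σ * τ := by
      rw [← hk]
      exact (Commute.refl σ).zpow_left k
    have := DFunLike.congr_fun h (Coord.eval α (1, 0))
    simp only [Equiv.Perm.mul_apply, hσ, hτ] at this
    exact absurd (hinj this) (by decide)
  have : Fact (Nat.Prime 3) := ⟨Nat.prime_three⟩
  exact ⟨paleyClique₇.isMaximalPaleyClique hα hF, paleyClique₇.ncard_eq hα, σ, τ, hσ', hτ', hσ3,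
    hτ2, hτστ,
    Set.Subset.antisymm
      ((Subgroup.closure_le (paleyStabSubgroup (paleyClique₇ α))).2
        (Set.insert_subset hσC (Set.singleton_subset_iff.2 hτC)))
      (paleyClique₇.paleyStab_subset_closure hα hF hσ hτ hσC hτC),
    ⟨DihedralGroup.closureEquiv hσ3 hτ2 hτστ (orderOf_eq_prime hσ3 hσ1) hτσ⟩⟩
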